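/- arXiv:math/0606646 — 3 statements merged into one kernel-verified Lean document; each statement's English description precedes it below -/
import Mathlib

section
/- Let A₁, A₂, …, A_N be a finite family of nonempty closed convex subsets of ℝⁿ (Euclidean space with the standard inner product ⟨·,·⟩), and for a convex set A let I(A) := {x ∈ ℝⁿ : ⟨x,y⟩ > 0 for all y ∈ A}. If α₁,…,α_N are real numbers such that Σᵢ αᵢ·1_{Aᵢ}(x) = 0 for every x ∈ ℝⁿ, then Σᵢ αᵢ·1_{I(Aᵢ)}(x) = 0 for every x ∈ ℝⁿ, where 1_S denotes the indicator function of a set S. -/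
open scoped RealInnerProductSpace

open Classical in
/-- Just to the right of `t`, the indicator of a closed convex subset of `ℝ` drops by one exactly
when `t` is the greatest element. -/
theorem eventually_indicator_sub_eq_isGreatest {S : Set ℝ} (hcl : IsClosed S) (hcv : Convex ℝ S)
    (t : ℝ) :
    ∀ᶠ s in nhdsWithin t (Set.Ioi t),
      S.indicator (1 : ℝ → ℝ) t - S.indicator 1 s = if IsGreatest S t then 1 else 0 := by
  by_cases ht : t ∈ S
  · by_cases hg : IsGreatest S t
    · filter_upwards [self_mem_nhdsWithin] with s hs
      have hs' : s ∉ S := fun h => absurd (hg.2 h) (not_le.2 hs)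
      simp [ht, hg, hs']
    · obtain ⟨u, hu, htu⟩ : ∃ u ∈ S, t < u := by
        by_contra! hcon
        exact hg ⟨ht, hcon⟩
      filter_upwards [Ioo_mem_nhdsGT htu] with s hs
      have hs' : s ∈ S := hcv.ordConnected.out ht hu ⟨hs.1.le, hs.2.le⟩
      simp [ht, hg, hs']
  · have hg : ¬ IsGreatest S t := fun h => ht h.1
    filter_upwards [mem_nhdsWithin_of_mem_nhds (hcl.isOpen_compl.mem_nhds ht)] with s hs
    have hs' : s ∉ S := hs
    simp [ht, hg, hs']

open Classical in
/-- The Euler characteristic respects linear relations among compact intervals of `ℝ`. -/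
theorem sum_mul_nonempty_eq_zero_of_real {ι : Type*} [Fintype ι] {S : ι → Set ℝ}
    (hS : ∀ i, IsCompact (S i)) (hcv : ∀ i, Convex ℝ (S i)) {c : ι → ℝ}
    (h : ∀ t, ∑ i, c i * (S i).indicator 1 t = 0) :
    ∑ i, c i * (if (S i).Nonempty then 1 else 0) = 0 := by
  have hmax (t : ℝ) : ∑ i, c i * (if IsGreatest (S i) t then 1 else 0) = 0 := by
    have hev := Filter.eventually_all.2 fun i =>
      eventually_indicator_sub_eq_isGreatest (hS i).isClosed (hcv i) t
    obtain ⟨s, hs⟩ := hev.exists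
    simp_rw [← hs, mul_sub, Finset.sum_sub_distrib, h, sub_zero]
  have hcount (i : ι) : (if (S i).Nonempty then (1 : ℝ) else 0) =
      ∑ t ∈ Finset.univ.image fun j => sSup (S j), if IsGreatest (S i) t then 1 else 0 := by
    by_cases hi : (S i).Nonempty
    · have hgr : IsGreatest (S i) (sSup (S i)) := (hS i).isGreatest_sSup hi
      rw [Finset.sum_eq_single (sSup (S i))]
      · simp [hi, hgr]
      · exact fun t _ ht => if_neg fun hg => ht (hg.unique hgr)
      · exact fun hni => absurd (Finset.mem_image_of_mem _ (Finset.mem_univ i)) hni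
    · rw [if_neg hi, Finset.sum_eq_zero]
      exact fun t _ => if_neg fun hg => hi ⟨t, hg.1⟩
  simp_rw [hcount, Finset.mul_sum]
  rw [Finset.sum_comm]
  exact Finset.sum_eq_zero fun t _ => hmax t

open Classical in
/-- The Euler characteristic of slices by coordinate subspaces respects linear relations among
compact convex sets. -/
theorem sum_mul_slice_nonempty_eq_zero {κ ι : Type*} [Fintype κ] [Fintype ι]
    {K : ι → Set (EuclideanSpace ℝ κ)}
    (hK : ∀ i, IsCompact (K i)) (hcv : ∀ i, Convex ℝ (K i)) {c : ι → ℝ}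
    (h : ∀ x, ∑ i, c i * (K i).indicator 1 x = 0) (J : Finset κ) (a : κ → ℝ) :
    ∑ i, c i * (if ∃ x ∈ K i, ∀ j ∉ J, x j = a j then 1 else 0) = 0 := by
  induction J using Finset.induction_on generalizing a with
  | empty =>
    refine Eq.trans (Finset.sum_congr rfl fun i _ => ?_) (h (WithLp.toLp 2 a))
    have : (∃ x ∈ K i, ∀ j ∉ (∅ : Finset κ), x j = a j) ↔ WithLp.toLp 2 a ∈ K i := by
      constructor
      · rintro ⟨x, hx, hxa⟩
        have : x = WithLp.toLp 2 a := by
          ext j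
          exact hxa j (Finset.notMem_empty j)
        rwa [← this]
      · exact fun ha => ⟨_, ha, fun j _ => rfl⟩
    simp only [Set.indicator_apply, this, Pi.one_apply]
  | insert k J hk ih =>
    let π : EuclideanSpace ℝ κ →L[ℝ] ℝ := EuclideanSpace.proj k
    let F : Set (EuclideanSpace ℝ κ) := {x | ∀ j ∉ insert k J, x j = a j}
    have hFcl : IsClosed F := by
      simp only [F, Set.ofPred_forall]
      refine isClosed_iInter fun j => isClosed_iInter fun _ => ?_
      exact isClosed_eq (by fun_prop) continuous_const
    have hFcv : Convex ℝ F := by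
      intro x hx y hy s t _ _ hst j hj
      simp only [PiLp.add_apply, PiLp.smul_apply, smul_eq_mul, hx j hj, hy j hj, ← add_mul, hst,
        one_mul]
    have key := sum_mul_nonempty_eq_zero_of_real (S := fun i => π '' (K i ∩ F)) (c := c)
      (fun i => ((hK i).inter_right hFcl).image π.continuous)
      (fun i => ((hcv i).inter hFcv).linear_image π.toLinearMap) ?_
    · have hne (i : ι) : (π '' (K i ∩ F)).Nonempty ↔
          ∃ x ∈ K i, ∀ j ∉ insert k J, x j = a j := Set.image_nonempty
      simpa only [hne] using key
    · intro t
      refine Eq.trans (Finset.sum_congr rfl fun i _ => ?_) (ih (Function.update a k t))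
      have : t ∈ π '' (K i ∩ F) ↔ ∃ x ∈ K i, ∀ j ∉ J, x j = Function.update a k t j := by
        constructor
        · rintro ⟨x, ⟨hx, hxF⟩, rfl⟩
          refine ⟨x, hx, fun j hj => ?_⟩
          by_cases hjk : j = k
          · subst hjk
            simp [π]
          · rw [Function.update_of_ne hjk]
            exact hxF j (by simp [hjk, hj])
        · rintro ⟨x, hx, hxa⟩
          refine ⟨x, ⟨hx, fun j hj => ?_⟩, ?_⟩
          · rw [Finset.mem_insert, not_or] at hj
            rw [hxa j hj.2, Function.update_of_ne hj.1]
          · simpa [π] using hxa k hk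
      simp only [Set.indicator_apply, this, Pi.one_apply]

/-- Linear relations among indicators persist after intersecting with a fixed set. -/
theorem sum_mul_indicator_inter_eq_zero {E ι : Type*} [Fintype ι] {K : ι → Set E} {c : ι → ℝ}
    (h : ∀ x, ∑ i, c i * (K i).indicator 1 x = 0) (B : Set E) (x : E) :
    ∑ i, c i * (K i ∩ B).indicator 1 x = 0 := by
  by_cases hx : x ∈ B
  · refine Eq.trans (Finset.sum_congr rfl fun i _ => ?_) (h x)
    by_cases hi : x ∈ K i <;> simp [hx, hi]
  · simp [hx]

open Classical in
/-- The Euler characteristic respects linear relations among closed convex sets. -/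
theorem sum_mul_nonempty_eq_zero {κ ι : Type*} [Fintype κ] [Fintype ι]
    {K : ι → Set (EuclideanSpace ℝ κ)}
    (hcl : ∀ i, IsClosed (K i)) (hcv : ∀ i, Convex ℝ (K i)) {c : ι → ℝ}
    (h : ∀ x, ∑ i, c i * (K i).indicator 1 x = 0) :
    ∑ i, c i * (if (K i).Nonempty then 1 else 0) = 0 := by
  have hpt (i : ι) : ∃ y, (K i).Nonempty → y ∈ K i := by
    by_cases hi : (K i).Nonempty
    · exact hi.imp fun y hy _ => hy
    · exact ⟨0, fun hn => absurd hn hi⟩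
  choose y hy using hpt
  let B : Set (EuclideanSpace ℝ κ) := Metric.closedBall 0 (∑ i, ‖y i‖)
  have hB (i : ι) : (K i ∩ B).Nonempty ↔ (K i).Nonempty := by
    refine ⟨fun hn => hn.mono Set.inter_subset_left, fun hn => ⟨y i, hy i hn, ?_⟩⟩
    rw [mem_closedBall_zero_iff]
    exact Finset.single_le_sum (f := fun i => ‖y i‖) (fun j _ => norm_nonneg _)
      (Finset.mem_univ i)
  have key := sum_mul_slice_nonempty_eq_zero (K := fun i => K i ∩ B)
    (fun i => (isCompact_closedBall _ _).inter_left (hcl i))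
    (fun i => (hcv i).inter (convex_closedBall _ _))
    (sum_mul_indicator_inter_eq_zero h B) Finset.univ 0
  simp_rw [← hB]
  simpa [Set.Nonempty] using key

/-- The map `A ↦ I(A) = {x : ⟪x,y⟫ > 0 ∀ y ∈ A}` preserves linear relations among
indicator functions of nonempty closed convex sets. -/
theorem stmt8 (n N : ℕ) (A : Fin N → Set (EuclideanSpace ℝ (Fin n)))
    (hne : ∀ i, (A i).Nonempty) (hcl : ∀ i, IsClosed (A i))
    (hcv : ∀ i, Convex ℝ (A i)) (c : Fin N → ℝ)
    (h : ∀ x, ∑ i, c i * Set.indicator (A i) 1 x = 0) :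
    ∀ x, ∑ i, c i *
      Set.indicator {z : EuclideanSpace ℝ (Fin n) | ∀ y ∈ A i, 0 < ⟪z, y⟫} 1 x = 0 := by
  classical
  intro x
  let H : Set (EuclideanSpace ℝ (Fin n)) := {y | ⟪x, y⟫ ≤ 0}
  have hHcl : IsClosed H := isClosed_le (by fun_prop) continuous_const
  have hHcv : Convex ℝ H := convex_halfSpace_le (innerₛₗ ℝ x).isLinear 0
  have hA := sum_mul_nonempty_eq_zero hcl hcv h
  have hAH := sum_mul_nonempty_eq_zero (K := fun i => A i ∩ H)
    (fun i => (hcl i).inter hHcl) (fun i => (hcv i).inter hHcv)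
    (sum_mul_indicator_inter_eq_zero h H)
  have hdiff := sub_eq_zero.2 (hA.trans hAH.symm)
  rw [← Finset.sum_sub_distrib] at hdiff
  refine Eq.trans (Finset.sum_congr rfl fun i _ => ?_) hdiff
  rw [← mul_sub, if_pos (hne i)]
  by_cases hi : (A i ∩ H).Nonempty
  · have hx : ¬ ∀ y ∈ A i, 0 < ⟪x, y⟫ := fun hall =>
      hi.elim fun y hy => absurd (hall y hy.1) (not_lt.2 hy.2)
    simp [hi, hx]
  · have hx : ∀ y ∈ A i, 0 < ⟪x, y⟫ := fun y hy => not_le.1 fun hle => hi ⟨y, hy, hle⟩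
    simp [Set.indicator_apply, hi, if_pos hx]
end

section
/- Let Q ⊆ ℝⁿ be a generalized n-permutohedron, i.e. a polytope (convex hull of a nonempty finite set) each of whose edges is parallel to e_i − e_j for some i ≠ j, where e₁,…,e_n are the standard basis vectors. Then there exist polynomials p, p* ∈ ℚ[X] such that for every positive integer m: p(m) equals the number of functions f : {1,…,n} → {1,…,m} for which the linear functional x ↦ Σᵢ f(i)xᵢ attains its minimum over Q at exactly one point; p*(m) equals Σ_{f : {1,…,n} → {1,…,m}} (number of vertices v of Q at which x ↦ Σᵢ f(i)xᵢ attains its minimum over Q); and p(−X) = (−1)ⁿ p*(X) as polynomials. -/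
/-- A generalized `n`-permutohedron: a polytope in `ℝⁿ` (convex hull of a nonempty finite
set) each of whose edges (faces that are nondegenerate closed segments) is parallel to
some `eᵢ - eⱼ`. -/
def IsGenPermutohedron (n : ℕ) (Q : Set (Fin n → ℝ)) : Prop :=
  (∃ V : Finset (Fin n → ℝ), V.Nonempty ∧ Q = convexHull ℝ (V : Set (Fin n → ℝ))) ∧
  ∀ u v : Fin n → ℝ, u ≠ v → IsExtreme ℝ Q (segment ℝ u v) →
    ∃ i j : Fin n, i ≠ j ∧ ∃ c : ℝ, c ≠ 0 ∧
      v - u = c • (Pi.single i (1 : ℝ) - Pi.single j (1 : ℝ))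

open Classical in
/-- Functions `α → {0,…,m}` with support `J` that are weakly increasing along `R`. -/
noncomputable def weakMaps {α : Type*} [Fintype α] (R : α → α → Prop) (J : Finset α) (m : ℕ) :
    Finset (α → ℕ) :=
  (Fintype.piFinset fun _ => Finset.range (m + 1)).filter fun f =>
    (∀ i, 0 < f i ↔ i ∈ J) ∧ ∀ a b, R a b → f a ≤ f b

open Classical in
/-- Functions `α → {0,…,m}` with support `J` that are strictly increasing along `R` on `J`. -/
noncomputable def strictMaps {α : Type*} [Fintype α] (R : α → α → Prop) (J : Finset α) (m : ℕ) :
    Finset (α → ℕ) :=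
  (Fintype.piFinset fun _ => Finset.range (m + 1)).filter fun f =>
    (∀ i, 0 < f i ↔ i ∈ J) ∧ ∀ a b, R a b → 0 < f a → f a < f b

section OrderPolynomial

variable {α : Type*} [Fintype α] {R : α → α → Prop} {J : Finset α} {m : ℕ}

lemma mem_weakMaps {f : α → ℕ} : f ∈ weakMaps R J m ↔
    (∀ i, f i ≤ m) ∧ (∀ i, 0 < f i ↔ i ∈ J) ∧ ∀ a b, R a b → f a ≤ f b := by
  simp [weakMaps]

lemma mem_strictMaps {f : α → ℕ} : f ∈ strictMaps R J m ↔
    (∀ i, f i ≤ m) ∧ (∀ i, 0 < f i ↔ i ∈ J) ∧ ∀ a b, R a b → 0 < f a → f a < f b := by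
  simp [strictMaps]

lemma weakMaps_eq_empty (hJ : ¬ ∀ a b, R a b → a ∈ J → b ∈ J) : weakMaps R J m = ∅ := by
  refine Finset.eq_empty_of_forall_notMem fun f hf => hJ fun a b hab ha => ?_
  obtain ⟨-, h2, h3⟩ := mem_weakMaps.1 hf
  exact (h2 b).1 (((h2 a).2 ha).trans_le (h3 a b hab))

lemma strictMaps_eq_empty (hJ : ¬ ∀ a b, R a b → a ∈ J → b ∈ J) : strictMaps R J m = ∅ := by
  refine Finset.eq_empty_of_forall_notMem fun f hf => hJ fun a b hab ha => ?_
  obtain ⟨-, h2, h3⟩ := mem_strictMaps.1 hf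
  exact (h2 b).1 (((h2 a).2 ha).trans (h3 a b hab ((h2 a).2 ha)))

open Classical in
lemma card_weakMaps_zero :
    (weakMaps R J 0).card = if J = ∅ then 1 else 0 := by
  split_ifs with h
  · subst h
    refine Finset.card_eq_one.2 ⟨0, Finset.ext fun f => ?_⟩
    rw [mem_weakMaps, Finset.mem_singleton]
    constructor
    · rintro ⟨h, -⟩
      exact funext fun i => Nat.le_zero.1 (h i)
    · rintro rfl
      simp
  · obtain ⟨i, hi⟩ := Finset.nonempty_iff_ne_empty.2 h
    refine Finset.card_eq_zero.2 (Finset.eq_empty_of_forall_notMem fun f hf => ?_)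
    obtain ⟨h1, h2, -⟩ := mem_weakMaps.1 hf
    exact absurd ((h2 i).2 hi) (by simpa using h1 i)

open Classical in
lemma card_strictMaps_zero :
    (strictMaps R J 0).card = if J = ∅ then 1 else 0 := by
  split_ifs with h
  · subst h
    refine Finset.card_eq_one.2 ⟨0, Finset.ext fun f => ?_⟩
    rw [mem_strictMaps, Finset.mem_singleton]
    constructor
    · rintro ⟨h, -⟩
      exact funext fun i => Nat.le_zero.1 (h i)
    · rintro rfl
      simp
  · obtain ⟨i, hi⟩ := Finset.nonempty_iff_ne_empty.2 h
    refine Finset.card_eq_zero.2 (Finset.eq_empty_of_forall_notMem fun f hf => ?_)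
    obtain ⟨h1, h2, -⟩ := mem_strictMaps.1 hf
    exact absurd ((h2 i).2 hi) (by simpa using h1 i)

open Classical in
lemma card_weakMaps_succ (hJ : ∀ a b, R a b → a ∈ J → b ∈ J) :
    (weakMaps R J (m + 1)).card = ∑ I ∈ J.powerset, (weakMaps R I m).card := by
  rw [← Finset.card_sigma]
  refine Finset.card_nbij' (fun f => ⟨Finset.univ.filter (2 ≤ f ·), fun i => f i - 1⟩)
    (fun g i => g.2 i + if i ∈ J then 1 else 0) ?_ ?_ ?_ ?_
  · intro f hf
    obtain ⟨h1, h2, h3⟩ := mem_weakMaps.1 hf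
    simp only [Finset.coe_sigma, Set.mem_sigma_iff, Finset.mem_coe, Finset.mem_powerset,
      mem_weakMaps]
    refine ⟨fun i hi => (h2 i).1 ?_, fun i => ?_, fun i => ?_, fun a b hab => ?_⟩
    · have := (Finset.mem_filter.1 hi).2
      omega
    · have := h1 i
      omega
    · simp only [Finset.mem_filter, Finset.mem_univ, true_and]
      omega
    · have := h3 a b hab
      omega
  · rintro ⟨I, g⟩ hg
    simp only [Finset.coe_sigma, Set.mem_sigma_iff, Finset.mem_coe, Finset.mem_powerset,
      mem_weakMaps] at hg ⊢
    obtain ⟨h0, h1, h2, h3⟩ := hg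
    refine ⟨fun i => ?_, fun i => ?_, fun a b hab => ?_⟩
    · have := h1 i
      split_ifs <;> omega
    · have := (h2 i)
      have := @h0 i
      split_ifs <;> grind
    · have := h3 a b hab
      have := hJ a b hab
      split_ifs <;> grind
  · intro f hf
    obtain ⟨h1, h2, h3⟩ := mem_weakMaps.1 hf
    funext i
    have := h2 i
    dsimp only
    split_ifs <;> grind
  · rintro ⟨I, g⟩ hg
    simp only [Finset.coe_sigma, Set.mem_sigma_iff, Finset.mem_coe, Finset.mem_powerset,
      mem_weakMaps] at hg
    obtain ⟨h0, h1, h2, h3⟩ := hg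
    have e1 : (Finset.univ.filter fun i => 2 ≤ g i + if i ∈ J then 1 else 0) = I := by
      ext i
      have := h2 i
      have := @h0 i
      simp only [Finset.mem_filter, Finset.mem_univ, true_and]
      split_ifs <;> grind
    have e2 : (fun i => (g i + if i ∈ J then 1 else 0) - 1) = g := by
      funext i
      have := h2 i
      have := @h0 i
      split_ifs <;> grind
    simp only [e1, e2]

open Classical in
lemma card_strictMaps_succ (hJ : ∀ a b, R a b → a ∈ J → b ∈ J) :
    (strictMaps R J (m + 1)).card =
      ∑ K ∈ J.powerset.filter (fun K => ∀ a ∈ J, a ∉ K → ∀ b, R a b → b ∈ K),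
        (strictMaps R K m).card := by
  rw [← Finset.card_sigma]
  refine Finset.card_nbij' (fun f => ⟨Finset.univ.filter (2 ≤ f ·), fun i => f i - 1⟩)
    (fun g i => g.2 i + if i ∈ J then 1 else 0) ?_ ?_ ?_ ?_
  · intro f hf
    obtain ⟨h1, h2, h3⟩ := mem_strictMaps.1 hf
    simp only [Finset.coe_sigma, Set.mem_sigma_iff, Finset.mem_coe, Finset.mem_powerset,
      Finset.mem_filter, mem_strictMaps, Finset.mem_univ, true_and]
    refine ⟨⟨fun i hi => (h2 i).1 ?_, fun a ha _ b hab => ?_⟩, fun i => ?_, fun i => ?_,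
      fun a b hab h => ?_⟩
    · have := (Finset.mem_filter.1 hi).2
      omega
    · have := h3 a b hab ((h2 a).2 ha)
      have := (h2 a).2 ha
      omega
    · have := h1 i
      omega
    · omega
    · have := h3 a b hab
      omega
  · rintro ⟨K, g⟩ hg
    simp only [Finset.coe_sigma, Set.mem_sigma_iff, Finset.mem_coe, Finset.mem_powerset,
      Finset.mem_filter, mem_strictMaps] at hg ⊢
    obtain ⟨⟨h0, h4⟩, h1, h2, h3⟩ := hg
    refine ⟨fun i => ?_, fun i => ?_, fun a b hab => ?_⟩
    · have := h1 i
      split_ifs <;> omega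
    · have := (h2 i)
      have := @h0 i
      split_ifs <;> grind
    · have := h3 a b hab
      have := hJ a b hab
      have := h4 a
      have := h2 a
      have := h2 b
      have := @h0 a
      split_ifs <;> grind
  · intro f hf
    obtain ⟨h1, h2, h3⟩ := mem_strictMaps.1 hf
    funext i
    have := h2 i
    dsimp only
    split_ifs <;> grind
  · rintro ⟨K, g⟩ hg
    simp only [Finset.coe_sigma, Set.mem_sigma_iff, Finset.mem_coe, Finset.mem_powerset,
      Finset.mem_filter, mem_strictMaps] at hg
    obtain ⟨⟨h0, -⟩, h1, h2, h3⟩ := hg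
    have e1 : (Finset.univ.filter fun i => 2 ≤ g i + if i ∈ J then 1 else 0) = K := by
      ext i
      have := h2 i
      have := @h0 i
      simp only [Finset.mem_filter, Finset.mem_univ, true_and]
      split_ifs <;> grind
    have e2 : (fun i => (g i + if i ∈ J then 1 else 0) - 1) = g := by
      funext i
      have := h2 i
      have := @h0 i
      split_ifs <;> grind
    simp only [e1, e2]

open Classical in
lemma sum_neg_one_pow_card_independent {h : α → ℝ} (hR : ∀ a b, R a b → h a < h b)
    (hJ : ∀ a b, R a b → a ∈ J → b ∈ J) {K : Finset α} (hKJ : K ⊆ J) :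
    ∑ I ∈ J.powerset.filter (fun I => K ⊆ I ∧ ∀ a ∈ I, a ∉ K → ∀ b, R a b → b ∈ K),
      (-1 : ℤ) ^ I.card = if K = J then (-1) ^ J.card else 0 := by
  set M := (J \ K).filter fun a => ∀ b, R a b → b ∈ K with hM
  have key : ∑ I ∈ J.powerset.filter (fun I => K ⊆ I ∧ ∀ a ∈ I, a ∉ K → ∀ b, R a b → b ∈ K),
      (-1 : ℤ) ^ I.card = ∑ T ∈ M.powerset, (-1 : ℤ) ^ K.card * (-1) ^ T.card := by
    refine Finset.sum_nbij' (· \ K) (K ∪ ·) ?_ ?_ ?_ ?_ ?_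
    · intro I hI
      simp only [Finset.mem_filter, Finset.mem_powerset] at hI ⊢
      intro a ha
      grind
    · intro T hT
      simp only [Finset.mem_filter, Finset.mem_powerset] at hT ⊢
      grind
    · intro I hI
      simp only [Finset.mem_filter, Finset.mem_powerset] at hI
      exact Finset.union_sdiff_of_subset hI.2.1
    · intro T hT
      simp only [Finset.mem_powerset] at hT
      grind
    · intro I hI
      simp only [Finset.mem_filter, Finset.mem_powerset] at hI
      rw [← pow_add, add_comm, Finset.card_sdiff_add_card_eq_card hI.2.1]
  rw [key, ← Finset.mul_sum]
  split_ifs with hKJ'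
  · subst hKJ'
    simp [hM]
  · rw [Finset.sum_powerset_neg_one_pow_card_of_nonempty, mul_zero]
    have hne : (J \ K).Nonempty := by
      rw [Finset.sdiff_nonempty]
      exact fun h' => hKJ' (hKJ.antisymm h')
    obtain ⟨a, ha, hmax⟩ := (J \ K).exists_max_image h hne
    refine ⟨a, Finset.mem_filter.2 ⟨ha, fun b hab => ?_⟩⟩
    by_contra hb
    exact (hR a b hab).not_ge (hmax b (Finset.mem_sdiff.2
      ⟨hJ a b hab (Finset.mem_sdiff.1 ha).1, hb⟩))

lemma sum_neg_one_pow_card_mul_card_strictMaps {h : α → ℝ} (hR : ∀ a b, R a b → h a < h b)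
    (hJ : ∀ a b, R a b → a ∈ J → b ∈ J) :
    ∑ I ∈ J.powerset, (-1 : ℤ) ^ I.card * (strictMaps R I (m + 1)).card =
      (-1) ^ J.card * (strictMaps R J m).card := by
  classical
  have h1 : ∀ I ∈ J.powerset, (-1 : ℤ) ^ I.card * (strictMaps R I (m + 1)).card =
      ∑ K ∈ J.powerset, if K ⊆ I ∧ ∀ a ∈ I, a ∉ K → ∀ b, R a b → b ∈ K then
        (-1 : ℤ) ^ I.card * (strictMaps R K m).card else 0 := by
    intro I hI
    rw [Finset.mem_powerset] at hI
    by_cases hU : ∀ a b, R a b → a ∈ I → b ∈ I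
    · rw [card_strictMaps_succ hU, Nat.cast_sum, Finset.mul_sum, ← Finset.sum_filter]
      refine Finset.sum_congr (Finset.ext fun K => ?_) fun _ _ => rfl
      simp only [Finset.mem_filter, Finset.mem_powerset]
      exact ⟨fun h => ⟨h.1.trans hI, h⟩, fun h => h.2⟩
    · rw [strictMaps_eq_empty hU, Finset.card_empty, Nat.cast_zero, mul_zero, eq_comm]
      refine Finset.sum_eq_zero fun K _ => ?_
      split_ifs with hc
      · rw [strictMaps_eq_empty, Finset.card_empty, Nat.cast_zero, mul_zero]
        intro hK
        refine hU fun a b hab ha => hc.1 ?_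
        by_cases haK : a ∈ K
        · exact hK a b hab haK
        · exact hc.2 a ha haK b hab
      · rfl
  rw [Finset.sum_congr rfl h1, Finset.sum_comm]
  have h2 : ∀ K ∈ J.powerset, (∑ I ∈ J.powerset,
      if K ⊆ I ∧ ∀ a ∈ I, a ∉ K → ∀ b, R a b → b ∈ K then
        (-1 : ℤ) ^ I.card * (strictMaps R K m).card else 0) =
      if K = J then (-1 : ℤ) ^ J.card * (strictMaps R K m).card else 0 := by
    intro K hK
    rw [← Finset.sum_filter, ← Finset.sum_mul]
    by_cases hU : ∀ a b, R a b → a ∈ K → b ∈ K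
    · rw [sum_neg_one_pow_card_independent hR hJ (Finset.mem_powerset.1 hK), ite_mul, zero_mul]
    · simp [strictMaps_eq_empty hU]
  rw [Finset.sum_congr rfl h2, Finset.sum_ite_eq']
  simp

/-- Every polynomial over `ℚ` has a discrete antiderivative with prescribed constant term. -/
lemma exists_antidifference (p : Polynomial ℚ) (c : ℚ) :
    ∃ q : Polynomial ℚ, q.eval 0 = c ∧ ∀ x, q.eval (x + 1) = q.eval x + p.eval x := by
  have : ∃ q : Polynomial ℚ, ∀ x, q.eval (x + 1) = q.eval x + p.eval x := by
    induction p using Polynomial.induction_on' with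
    | add p₁ p₂ h₁ h₂ =>
      obtain ⟨q₁, h₁⟩ := h₁
      obtain ⟨q₂, h₂⟩ := h₂
      refine ⟨q₁ + q₂, fun x => ?_⟩
      simp only [Polynomial.eval_add, h₁, h₂]
      ring
    | monomial k a =>
      refine ⟨Polynomial.C (a / (k + 1)) * Polynomial.bernoulli (k + 1), fun x => ?_⟩
      have hk : (k : ℚ) + 1 ≠ 0 := by positivity
      rw [Polynomial.eval_mul, add_comm x 1, Polynomial.bernoulli_eval_one_add]
      simp
      field_simp
  obtain ⟨q, hq⟩ := this
  refine ⟨q + Polynomial.C (c - q.eval 0), by simp, fun x => ?_⟩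
  simp only [Polynomial.eval_add, hq, Polynomial.eval_C]
  ring

lemma exists_orderPolynomial {h : α → ℝ} (hR : ∀ a b, R a b → h a < h b) (J : Finset α) :
    ∃ q : Polynomial ℚ, (∀ m : ℕ, q.eval (m : ℚ) = (weakMaps R J m).card) ∧
      ∀ m : ℕ, q.eval (-m : ℚ) = (-1) ^ J.card * (strictMaps R J m).card := by
  classical
  induction J using Finset.strongInduction with
  | H J ih =>
  by_cases hJ : ∀ a b, R a b → a ∈ J → b ∈ J
  swap
  · exact ⟨0, by simp [weakMaps_eq_empty hJ], by simp [strictMaps_eq_empty hJ]⟩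
  choose! q hqw hqs using ih
  obtain ⟨r, hr0, hr⟩ := exists_antidifference (∑ I ∈ J.ssubsets, q I) (if J = ∅ then 1 else 0)
  have hsplit : ∀ F : Finset α → ℚ, ∑ I ∈ J.powerset, F I = F J + ∑ I ∈ J.ssubsets, F I := by
    intro F
    rw [Finset.ssubsets, Finset.add_sum_erase _ _ (Finset.mem_powerset_self J)]
  refine ⟨r, fun m => ?_, fun m => ?_⟩
  · induction m with
    | zero =>
      rw [card_weakMaps_zero, Nat.cast_zero, hr0]
      simp
    | succ m ihm =>
      rw [card_weakMaps_succ hJ, Nat.cast_sum, hsplit, Nat.cast_succ, hr, ihm,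
        Polynomial.eval_finsetSum]
      congr 1
      exact Finset.sum_congr rfl fun I hI => hqw I (Finset.mem_ssubsets.1 hI) m
  · induction m with
    | zero =>
      rw [card_strictMaps_zero, Nat.cast_zero, neg_zero, hr0]
      split_ifs with h0 <;> simp [h0]
    | succ m ihm =>
      have h1 := hr (-((m + 1 : ℕ) : ℚ))
      have h2 : (-((m + 1 : ℕ) : ℚ)) + 1 = -m := by push_cast; ring
      rw [h2, ihm, Polynomial.eval_finsetSum, Finset.sum_congr rfl
        fun I hI => hqs I (Finset.mem_ssubsets.1 hI) (m + 1)] at h1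
      have h3 := congrArg (Int.cast : ℤ → ℚ)
        (sum_neg_one_pow_card_mul_card_strictMaps (m := m) hR hJ)
      push_cast at h3
      rw [hsplit] at h3
      linarith

end OrderPolynomial

section Edges

variable {E : Type*} [NormedAddCommGroup E] [NormedSpace ℝ E] {v : E}

lemma exists_smul_of_mem_convexHull {s P : Set E} (hP : Convex ℝ P)
    (hs : ∀ w ∈ s, ∃ t : ℝ, 0 ≤ t ∧ ∃ p ∈ P, w = v + t • p) {x : E} (hx : x ∈ convexHull ℝ s) :
    ∃ t : ℝ, 0 ≤ t ∧ ∃ p ∈ P, x = v + t • p := by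
  have hC : Convex ℝ {x : E | ∃ t : ℝ, 0 ≤ t ∧ ∃ p ∈ P, x = v + t • p} := by
    rintro _ ⟨t, ht, p, hp, rfl⟩ _ ⟨r, hr, q, hq, rfl⟩ a b ha hb hab
    have hat := mul_nonneg ha ht
    have hbr := mul_nonneg hb hr
    have hv : a • (v + t • p) + b • (v + r • q) = v + ((a * t) • p + (b * r) • q) := by
      have : v = a • v + b • v := by rw [← add_smul, hab, one_smul]
      nth_rewrite 3 [this]
      module
    rw [Set.mem_ofPred_eq, hv]
    rcases (add_nonneg hat hbr).eq_or_lt with h0 | h0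
    · refine ⟨0, le_rfl, p, hp, ?_⟩
      have h1 : a * t = 0 := by linarith
      have h2 : b * r = 0 := by linarith
      simp [h1, h2]
    · refine ⟨a * t + b * r, h0.le, (a * t / (a * t + b * r)) • p + (b * r / (a * t + b * r)) • q,
        hP hp hq (by positivity) (by positivity) (by field_simp), ?_⟩
      rw [smul_add, smul_smul, smul_smul, mul_div_cancel₀ _ h0.ne', mul_div_cancel₀ _ h0.ne']
  exact convexHull_min hs hC hx

lemma erase_nonempty_of_mem_convexHull [DecidableEq E] {V : Finset E} {x : E}
    (hx : x ∈ convexHull ℝ (V : Set E)) (hxv : x ≠ v) : (V.erase v).Nonempty := by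
  by_contra hemp
  rw [Finset.not_nonempty_iff_eq_empty] at hemp
  have hVv : (V : Set E) ⊆ {v} := fun y hy => by
    by_contra hyv
    exact Finset.notMem_empty y (hemp ▸ Finset.mem_erase.2 ⟨hyv, hy⟩)
  have := convexHull_mono (𝕜 := ℝ) hVv hx
  rw [convexHull_singleton] at this
  exact hxv this

lemma exists_exposing_functional {V : Finset E}
    (hv : v ∈ (convexHull ℝ (V : Set E)).extremePoints ℝ) :
    ∃ h : StrongDual ℝ E, ∀ x ∈ convexHull ℝ (V : Set E), x ≠ v → h v < h x := by
  classical
  have hv' : v ∉ convexHull ℝ ((V.erase v : Finset E) : Set E) := by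
    have := ((convex_convexHull ℝ _).mem_extremePoints_iff_mem_sdiff_convexHull_sdiff.1 hv).2
    refine fun h => this (convexHull_mono (𝕜 := ℝ) ?_ h)
    rw [Finset.coe_erase]
    exact Set.sdiff_subset_sdiff_left (subset_convexHull ℝ _)
  obtain ⟨h, u, hu, hb⟩ := geometric_hahn_banach_point_closed (convex_convexHull ℝ _)
    ((V.erase v).finite_toSet.isCompact_convexHull (𝕜 := ℝ)).isClosed hv'
  refine ⟨h, fun x hx hxv => ?_⟩
  have hP : Convex ℝ {y : E | 0 < h y} := convex_halfSpace_gt h.toLinearMap.isLinear 0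
  have hpos : ∀ w ∈ V.erase v, 0 < h (w - v) := fun w hw => by
    rw [map_sub, sub_pos]
    exact hu.trans (hb w (subset_convexHull ℝ _ (Finset.mem_coe.2 hw)))
  obtain ⟨w₀, hw₀⟩ := erase_nonempty_of_mem_convexHull hx hxv
  obtain ⟨t, ht, p, hp, rfl⟩ := exists_smul_of_mem_convexHull (v := v) hP (fun w hw => by
    by_cases hwv : w = v
    · exact ⟨0, le_rfl, w₀ - v, hpos w₀ hw₀, by simp [hwv]⟩
    · exact ⟨1, zero_le_one, w - v, hpos w (Finset.mem_erase.2 ⟨hwv, hw⟩), by simp⟩) hx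
  have ht' : 0 < t := ht.lt_of_ne fun h0 => hxv (by simp [← h0])
  rw [map_add, map_smul, smul_eq_mul]
  exact lt_add_of_pos_right _ (mul_pos ht' hp)

lemma exists_edge_le {V : Finset E} (hv : v ∈ (convexHull ℝ (V : Set E)).extremePoints ℝ)
    (f : StrongDual ℝ E) {w : E} (hw : w ∈ convexHull ℝ (V : Set E)) (hwv : w ≠ v) :
    ∃ u, v ≠ u ∧ IsExtreme ℝ (convexHull ℝ (V : Set E)) (segment ℝ v u) ∧
      ∃ t : ℝ, 0 < t ∧ f (u - v) ≤ t * f (w - v) := by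
  classical
  set Q := convexHull ℝ (V : Set E) with hQ
  obtain ⟨h, hh⟩ := exists_exposing_functional hv
  have hpos : ∀ x ∈ Q, x ≠ v → 0 < h (x - v) := fun x hx hxv => by
    rw [map_sub, sub_pos]
    exact hh x hx hxv
  set N : Finset E := (V.erase v).image fun w => (h (w - v))⁻¹ • (w - v) with hN
  set P := convexHull ℝ (N : Set E) with hPdef
  have hPc : Convex ℝ P := convex_convexHull ℝ _
  have hPcomp : IsCompact P := N.finite_toSet.isCompact_convexHull (𝕜 := ℝ)
  have hPne : P.Nonempty := by
    rw [hPdef, convexHull_nonempty_iff, Finset.coe_nonempty, hN, Finset.image_nonempty]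
    exact erase_nonempty_of_mem_convexHull hw hwv
  have hP1 : ∀ p ∈ P, h p = 1 := by
    have : P ⊆ {p | h p = 1} := by
      refine convexHull_min ?_ (convex_hyperplane h.toLinearMap.isLinear 1)
      intro p hp
      obtain ⟨w, hw, rfl⟩ := Finset.mem_image.1 hp
      rw [Set.mem_ofPred_eq, map_smul, smul_eq_mul]
      exact inv_mul_cancel₀ (hpos w (subset_convexHull ℝ _ (Finset.mem_of_mem_erase hw))
        (Finset.ne_of_mem_erase hw)).ne'
    exact this
  have hcone : ∀ x ∈ Q, ∃ p ∈ P, x - v = h (x - v) • p := by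
    intro x hx
    obtain ⟨t, -, p, hp, rfl⟩ := exists_smul_of_mem_convexHull (v := v) hPc (fun w hw => by
      by_cases hwv : w = v
      · exact ⟨0, le_rfl, hPne.some, hPne.some_mem, by simp [hwv]⟩
      · have := hpos w (subset_convexHull ℝ _ hw) hwv
        refine ⟨h (w - v), this.le, (h (w - v))⁻¹ • (w - v), subset_convexHull ℝ _
          (Finset.mem_image_of_mem _ (Finset.mem_erase.2 ⟨hwv, hw⟩)), ?_⟩
        rw [smul_inv_smul₀ this.ne', add_sub_cancel]) hx
    exact ⟨p, hp, by simp [hP1 p hp]⟩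
  obtain ⟨d, hdP, hdmin⟩ : ∃ d ∈ P.extremePoints ℝ, ∀ p ∈ P, f d ≤ f p := by
    obtain ⟨p₀, hp₀, hmin⟩ := hPcomp.exists_isMinOn hPne f.continuous.continuousOn
    have hexp : IsExposed ℝ P {x ∈ P | ∀ y ∈ P, (-f) y ≤ (-f) x} := fun _ => ⟨-f, rfl⟩
    obtain ⟨d, hd⟩ := (hexp.isCompact hPcomp).extremePoints_nonempty
      ⟨p₀, hp₀, fun y hy => neg_le_neg (hmin hy)⟩
    exact ⟨d, hexp.isExtreme.extremePoints_subset_extremePoints hd,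
      fun p hp => neg_le_neg_iff.1 (hd.1.2 p hp)⟩
  obtain ⟨z, hzQ, hzv, hzd⟩ : ∃ z ∈ Q, z ≠ v ∧ z - v = h (z - v) • d := by
    obtain ⟨z, hz, hzd⟩ := Finset.mem_image.1 (extremePoints_convexHull_subset (𝕜 := ℝ) hdP)
    have hzQ : z ∈ Q := subset_convexHull ℝ _ (Finset.mem_of_mem_erase hz)
    refine ⟨z, hzQ, Finset.ne_of_mem_erase hz, ?_⟩
    rw [← hzd, smul_inv_smul₀ (hpos z hzQ (Finset.ne_of_mem_erase hz)).ne']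
  have hQcomp : IsCompact Q := V.finite_toSet.isCompact_convexHull (𝕜 := ℝ)
  have hFcomp : IsCompact (Q ∩ {x | x - v = h (x - v) • d}) :=
    hQcomp.inter_right (isClosed_eq (by fun_prop) (by fun_prop))
  obtain ⟨u, ⟨huQ, hud⟩, humax⟩ := hFcomp.exists_isMaxOn ⟨z, hzQ, hzd⟩ h.continuous.continuousOn
  have humax' : ∀ x ∈ Q, x - v = h (x - v) • d → h (x - v) ≤ h (u - v) := fun x hx hxd => by
    rw [map_sub, map_sub]
    exact sub_le_sub_right (humax ⟨hx, hxd⟩) _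
  have huv : u ≠ v := by
    rintro rfl
    have := humax' z hzQ hzd
    rw [sub_self, map_zero] at this
    exact this.not_gt (hpos z hzQ hzv)
  have hupos := hpos u huQ huv
  have hseg : ∀ x, x ∈ segment ℝ v u ↔ x ∈ Q ∧ x - v = h (x - v) • d := by
    intro x
    constructor
    · intro hx
      refine ⟨(convex_convexHull ℝ _).segment_subset hv.1 huQ hx, ?_⟩
      rw [segment_eq_image'] at hx
      obtain ⟨θ, -, rfl⟩ := hx
      dsimp only
      rw [add_sub_cancel_left, map_smul, smul_eq_mul, mul_smul, ← hud]
    · rintro ⟨hx, hxd⟩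
      rw [segment_eq_image']
      have h0 : 0 ≤ h (x - v) := by
        by_cases hxv : x = v
        · simp [hxv]
        · exact (hpos x hx hxv).le
      refine ⟨h (x - v) / h (u - v), ⟨by positivity, (div_le_one hupos).2 (humax' x hx hxd)⟩, ?_⟩
      dsimp only
      rw [hud, map_smul, hP1 d hdP.1, smul_eq_mul, mul_one, smul_smul, div_mul_cancel₀ _ hupos.ne',
        ← hxd, add_sub_cancel]
  refine ⟨u, huv.symm, ⟨fun x hx => ((hseg x).1 hx).1, ?_⟩, ?_⟩
  · intro x hx y hy y' hy' hmem
    obtain ⟨-, hy'd⟩ := (hseg y').1 hy'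
    refine (hseg x).2 ⟨hx, ?_⟩
    by_cases hxv : x = v
    · simp [hxv]
    by_cases hyv : y = v
    · subst hyv
      obtain ⟨a, b, ha, hb, hab, rfl⟩ := hmem
      have : a • x + b • y - y = a • (x - y) := by
        rw [← eq_sub_iff_add_eq] at hab
        rw [hab]
        module
      rw [this, map_smul, smul_eq_mul, mul_smul] at hy'd
      exact smul_right_injective E ha.ne' hy'd
    obtain ⟨a, b, ha, hb, hab, rfl⟩ := hmem
    obtain ⟨p, hp, hxp⟩ := hcone x hx
    obtain ⟨q, hq, hyq⟩ := hcone y hy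
    have hα := hpos x hx hxv
    have hβ := hpos y hy hyv
    set α := h (x - v) with hαdef
    set β := h (y - v) with hβdef
    have hlin : a • x + b • y - v = a • (x - v) + b • (y - v) := by
      rw [← eq_sub_iff_add_eq] at hab
      rw [hab]
      module
    rw [hlin, map_add, map_smul, map_smul, ← hαdef, ← hβdef, smul_eq_mul, smul_eq_mul, hxp, hyq,
      smul_smul, smul_smul] at hy'd
    have hs : 0 < a * α + b * β := by positivity
    have hpd : p = d := by
      refine hdP.2 hp hq ⟨a * α / (a * α + b * β), b * β / (a * α + b * β), by positivity,
        by positivity, by field_simp, ?_⟩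
      refine smul_right_injective E hs.ne' ?_
      dsimp only
      rw [← hy'd, smul_add, smul_smul, smul_smul, mul_div_cancel₀ _ hs.ne',
        mul_div_cancel₀ _ hs.ne']
    rw [hxp, hpd]
  · obtain ⟨p, hp, hwp⟩ := hcone w hw
    have hwpos := hpos w hw hwv
    refine ⟨h (u - v) / h (w - v), by positivity, ?_⟩
    rw [hud, map_smul, map_smul, hP1 d hdP.1, hwp, map_smul, map_smul, hP1 p hp, smul_eq_mul,
      smul_eq_mul, smul_eq_mul, smul_eq_mul, mul_one, mul_one, ← mul_assoc,
      div_mul_cancel₀ _ hwpos.ne']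
    exact mul_le_mul_of_nonneg_left (hdmin p hp) hupos.le

end Edges

/-- The relation on coordinates at a point `v` of `Q`: one can move inside `Q` from `v` in
direction `e_b - e_a`. -/
def exchangeRel {n : ℕ} (Q : Set (Fin n → ℝ)) (v : Fin n → ℝ) (a b : Fin n) : Prop :=
  a ≠ b ∧ ∃ c : ℝ, 0 < c ∧ v + c • (Pi.single b (1 : ℝ) - Pi.single a (1 : ℝ)) ∈ Q

section Permutohedron

variable {n : ℕ} {Q : Set (Fin n → ℝ)} {v : Fin n → ℝ}

lemma sum_mul_add_smul_single_sub (f v : Fin n → ℝ) (c : ℝ) (a b : Fin n) :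
    ∑ i, f i * (v + c • (Pi.single b (1 : ℝ) - Pi.single a (1 : ℝ)) : Fin n → ℝ) i =
      ∑ i, f i * v i + c * (f b - f a) := by
  have : ∀ i, f i * (v + c • (Pi.single b (1 : ℝ) - Pi.single a (1 : ℝ)) : Fin n → ℝ) i =
      f i * v i + (c * (f i * (Pi.single b (1 : ℝ) : Fin n → ℝ) i) -
        c * (f i * (Pi.single a (1 : ℝ) : Fin n → ℝ) i)) := by
    intro i
    simp only [Pi.add_apply, Pi.smul_apply, Pi.sub_apply, smul_eq_mul]
    ring
  simp only [this, Finset.sum_add_distrib, Finset.sum_sub_distrib, Pi.single_apply,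
    mul_ite, mul_one, mul_zero, Finset.sum_ite_eq', Finset.mem_univ, if_true]
  ring

lemma IsGenPermutohedron.exists_exchangeRel_le (hQ : IsGenPermutohedron n Q)
    (hv : v ∈ Q.extremePoints ℝ) (f : Fin n → ℝ) {w : Fin n → ℝ} (hw : w ∈ Q) (hwv : w ≠ v) :
    ∃ a b, exchangeRel Q v a b ∧ ∃ t : ℝ, 0 < t ∧
      f b - f a ≤ t * (∑ i, f i * w i - ∑ i, f i * v i) := by
  obtain ⟨⟨V, -, rfl⟩, hedge⟩ := hQ
  obtain ⟨u, hvu, hext, t, ht, hle⟩ := exists_edge_le hv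
    (∑ i, f i • ContinuousLinearMap.proj (R := ℝ) (φ := fun _ : Fin n => ℝ) i) hw hwv
  have hF : ∀ x : Fin n → ℝ,
      (∑ i, f i • ContinuousLinearMap.proj (R := ℝ) (φ := fun _ : Fin n => ℝ) i) x =
        ∑ i, f i * x i := fun x => by
    simp
  rw [map_sub, map_sub, hF, hF, hF] at hle
  have huQ := hext.subset (right_mem_segment ℝ v u)
  obtain ⟨i, j, hij, c, hc, hcu⟩ := hedge v u hvu hext
  rw [sub_eq_iff_eq_add'] at hcu
  subst hcu
  rw [sum_mul_add_smul_single_sub, add_sub_cancel_left] at hle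
  rcases hc.lt_or_gt with hc | hc
  · have hc' : 0 < -c := neg_pos.2 hc
    refine ⟨i, j, ⟨hij, -c, hc', ?_⟩, t / -c, by positivity, ?_⟩
    · rwa [neg_smul, ← smul_neg, neg_sub]
    · rw [div_mul_eq_mul_div, le_div_iff₀ hc']
      linarith
  · refine ⟨j, i, ⟨hij.symm, c, hc, huQ⟩, t / c, by positivity, ?_⟩
    rw [div_mul_eq_mul_div, le_div_iff₀ hc]
    linarith

lemma IsGenPermutohedron.forall_le_iff (hQ : IsGenPermutohedron n Q)
    (hv : v ∈ Q.extremePoints ℝ) (f : Fin n → ℝ) :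
    (∀ y ∈ Q, ∑ i, f i * v i ≤ ∑ i, f i * y i) ↔ ∀ a b, exchangeRel Q v a b → f a ≤ f b := by
  constructor
  · rintro h a b ⟨-, c, hc, hmem⟩
    have := h _ hmem
    rw [sum_mul_add_smul_single_sub] at this
    exact sub_nonneg.1 (nonneg_of_mul_nonneg_right (by linarith) hc)
  · intro h y hy
    by_contra! hlt
    have hyv : y ≠ v := by
      rintro rfl
      exact lt_irrefl _ hlt
    obtain ⟨a, b, hab, t, ht, hle⟩ := hQ.exists_exchangeRel_le hv f hy hyv
    have := h a b hab
    have := mul_neg_of_pos_of_neg ht (sub_neg.2 hlt)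
    linarith

lemma IsGenPermutohedron.forall_lt_iff (hQ : IsGenPermutohedron n Q)
    (hv : v ∈ Q.extremePoints ℝ) (f : Fin n → ℝ) :
    (∀ y ∈ Q, y ≠ v → ∑ i, f i * v i < ∑ i, f i * y i) ↔
      ∀ a b, exchangeRel Q v a b → f a < f b := by
  constructor
  · rintro h a b ⟨hab, c, hc, hmem⟩
    have := h _ hmem fun heq => by
      have := congrFun heq b
      simp [hab.symm, hc.ne'] at this
    rw [sum_mul_add_smul_single_sub] at this
    exact sub_pos.1 (pos_of_mul_pos_right (by linarith) hc.le)
  · intro h y hy hyv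
    by_contra! hge
    obtain ⟨a, b, hab, t, ht, hle⟩ := hQ.exists_exchangeRel_le hv f hy hyv
    have := h a b hab
    have := mul_nonpos_of_nonneg_of_nonpos ht.le (sub_nonpos.2 hge)
    linarith

lemma IsGenPermutohedron.exists_exchangeRel_lt (hQ : IsGenPermutohedron n Q)
    (hv : v ∈ Q.extremePoints ℝ) :
    ∃ h : Fin n → ℝ, ∀ a b, exchangeRel Q v a b → h a < h b := by
  obtain ⟨⟨V, -, hV⟩, -⟩ := id hQ
  obtain ⟨h, hh⟩ := exists_exposing_functional (hV ▸ hv)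
  refine ⟨fun i => h (Pi.single i 1), (hQ.forall_lt_iff hv _).1 fun y hy hyv => ?_⟩
  have key : ∀ x : Fin n → ℝ, ∑ i, h (Pi.single i 1) * x i = h x := fun x => by
    conv_rhs => rw [pi_eq_sum_univ' x, map_sum]
    refine Finset.sum_congr rfl fun i _ => ?_
    rw [map_smul, smul_eq_mul, mul_comm]
  rw [key, key]
  exact hh y (hV ▸ hy) hyv

lemma IsGenPermutohedron.finite_extremePoints (hQ : IsGenPermutohedron n Q) :
    (Q.extremePoints ℝ).Finite := by
  obtain ⟨⟨V, -, rfl⟩, -⟩ := hQ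
  exact V.finite_toSet.subset extremePoints_convexHull_subset

lemma mem_extremePoints_of_forall_lt {f : Fin n → ℝ} (hvQ : v ∈ Q)
    (h : ∀ y ∈ Q, y ≠ v → ∑ i, f i * v i < ∑ i, f i * y i) : v ∈ Q.extremePoints ℝ := by
  refine ⟨hvQ, fun x hx y hy hmem => ?_⟩
  by_contra hxv
  have hle : ∑ i, f i * v i ≤ ∑ i, f i * y i := by
    by_cases hyv : y = v
    · rw [hyv]
    · exact (h y hy hyv).le
  obtain ⟨a, b, ha, hb, hab, hv⟩ := hmem
  have e : ∑ i, f i * v i = a * ∑ i, f i * x i + b * ∑ i, f i * y i := by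
    rw [← hv, Finset.mul_sum, Finset.mul_sum, ← Finset.sum_add_distrib]
    refine Finset.sum_congr rfl fun i _ => ?_
    simp only [Pi.add_apply, Pi.smul_apply, smul_eq_mul]
    ring
  have h1 := mul_lt_mul_of_pos_left (h x hx hxv) ha
  have h2 := mul_le_mul_of_nonneg_left hle hb.le
  have h3 : ∑ i, f i * v i = a * ∑ i, f i * v i + b * ∑ i, f i * v i := by
    rw [← add_mul, hab, one_mul]
  linarith

lemma existsUnique_minimizer_iff {f : Fin n → ℝ} :
    (∃! x : Fin n → ℝ, x ∈ Q ∧ ∀ y ∈ Q, ∑ i, f i * x i ≤ ∑ i, f i * y i) ↔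
      ∃ v ∈ Q.extremePoints ℝ, ∀ y ∈ Q, y ≠ v → ∑ i, f i * v i < ∑ i, f i * y i := by
  constructor
  · rintro ⟨v, ⟨hvQ, hv⟩, huniq⟩
    have hlt : ∀ y ∈ Q, y ≠ v → ∑ i, f i * v i < ∑ i, f i * y i := fun y hy hyv =>
      (hv y hy).lt_of_ne fun heq => hyv (huniq y ⟨hy, fun z hz => heq ▸ hv z hz⟩)
    exact ⟨v, mem_extremePoints_of_forall_lt hvQ hlt, hlt⟩
  · rintro ⟨v, hv, hlt⟩
    refine ⟨v, ⟨hv.1, fun y hy => ?_⟩, fun y ⟨hy, hmin⟩ => ?_⟩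
    · by_cases hyv : y = v
      · rw [hyv]
      · exact (hlt y hy hyv).le
    · by_contra hyv
      exact (hlt y hy hyv).not_ge (hmin v hv.1)

lemma mem_weakMaps_univ {R : Fin n → Fin n → Prop} {m : ℕ} {f : Fin n → ℕ} :
    f ∈ weakMaps R Finset.univ m ↔ (∀ i, 1 ≤ f i ∧ f i ≤ m) ∧ ∀ a b, R a b → f a ≤ f b := by
  simp only [mem_weakMaps, Finset.mem_univ, iff_true, forall_and, Nat.succ_le_iff]
  tauto

lemma mem_strictMaps_univ {R : Fin n → Fin n → Prop} {m : ℕ} {f : Fin n → ℕ} :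
    f ∈ strictMaps R Finset.univ m ↔ (∀ i, 1 ≤ f i ∧ f i ≤ m) ∧ ∀ a b, R a b → f a < f b := by
  simp only [mem_strictMaps, Finset.mem_univ, iff_true, forall_and, Nat.succ_le_iff]
  constructor
  · rintro ⟨h1, h2, h3⟩
    exact ⟨⟨h2, h1⟩, fun a b hab => h3 a b hab (h2 a)⟩
  · rintro ⟨⟨h2, h1⟩, h3⟩
    exact ⟨h1, h2, fun a b hab _ => h3 a b hab⟩

lemma IsGenPermutohedron.card_unique_minimizer (hQ : IsGenPermutohedron n Q) (m : ℕ) :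
    Nat.card {f : Fin n → ℕ // (∀ i, 1 ≤ f i ∧ f i ≤ m) ∧
        ∃! x : Fin n → ℝ, x ∈ Q ∧ ∀ y ∈ Q, ∑ i, (f i : ℝ) * x i ≤ ∑ i, (f i : ℝ) * y i} =
      ∑ v ∈ hQ.finite_extremePoints.toFinset,
        (strictMaps (exchangeRel Q v) Finset.univ m).card := by
  have hmem : ∀ v ∈ Q.extremePoints ℝ, ∀ f : Fin n → ℕ,
      f ∈ strictMaps (exchangeRel Q v) Finset.univ m ↔ (∀ i, 1 ≤ f i ∧ f i ≤ m) ∧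
        ∀ y ∈ Q, y ≠ v → ∑ i, (f i : ℝ) * v i < ∑ i, (f i : ℝ) * y i := fun v hv f => by
    rw [mem_strictMaps_univ, hQ.forall_lt_iff hv fun i => (f i : ℝ)]
    simp only [Nat.cast_lt]
  rw [← Finset.card_biUnion]
  · refine Nat.subtype_card _ fun f => ?_
    rw [Finset.mem_biUnion, existsUnique_minimizer_iff (f := fun i => (f i : ℝ))]
    simp only [Set.Finite.mem_toFinset]
    constructor
    · rintro ⟨v, hv, hf⟩
      exact ⟨((hmem v hv f).1 hf).1, v, hv, ((hmem v hv f).1 hf).2⟩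
    · rintro ⟨hm, v, hv, hf⟩
      exact ⟨v, hv, (hmem v hv f).2 ⟨hm, hf⟩⟩
  · intro v hv w hw hvw
    rw [Finset.mem_coe, Set.Finite.mem_toFinset] at hv hw
    refine Finset.disjoint_left.2 fun f hfv hfw => ?_
    exact lt_asymm (((hmem v hv f).1 hfv).2 w hw.1 hvw.symm) (((hmem w hw f).1 hfw).2 v hv.1 hvw)

lemma IsGenPermutohedron.finsum_card_minimizing_vertices (hQ : IsGenPermutohedron n Q) (m : ℕ) :
    ∑ᶠ f ∈ {f : Fin n → ℕ | ∀ i, 1 ≤ f i ∧ f i ≤ m},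
        (Nat.card {x : Fin n → ℝ // x ∈ Set.extremePoints ℝ Q ∧
          ∀ y ∈ Q, ∑ i, (f i : ℝ) * x i ≤ ∑ i, (f i : ℝ) * y i} : ℚ) =
      ∑ v ∈ hQ.finite_extremePoints.toFinset,
        ((weakMaps (exchangeRel Q v) Finset.univ m).card : ℚ) := by
  classical
  set A : Finset (Fin n → ℕ) := Fintype.piFinset fun _ => Finset.Icc 1 m with hA
  have hmem : ∀ f, f ∈ A ↔ ∀ i, 1 ≤ f i ∧ f i ≤ m := fun f => by simp [hA]
  have hset : {f : Fin n → ℕ | ∀ i, 1 ≤ f i ∧ f i ≤ m} = A := by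
    ext f
    simp [hmem]
  rw [hset, finsum_mem_coe_finset]
  have hcard : ∀ f : Fin n → ℕ, Nat.card {x : Fin n → ℝ // x ∈ Set.extremePoints ℝ Q ∧
      ∀ y ∈ Q, ∑ i, (f i : ℝ) * x i ≤ ∑ i, (f i : ℝ) * y i} =
      ∑ v ∈ hQ.finite_extremePoints.toFinset,
        if ∀ a b, exchangeRel Q v a b → f a ≤ f b then 1 else 0 := fun f => by
    rw [← Finset.card_filter]
    refine Nat.subtype_card _ fun v => ?_
    rw [Finset.mem_filter, Set.Finite.mem_toFinset]
    refine and_congr_right fun hv => ?_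
    rw [hQ.forall_le_iff hv fun i => (f i : ℝ)]
    simp only [Nat.cast_le]
  simp only [hcard]
  rw [← Nat.cast_sum, ← Nat.cast_sum, Finset.sum_comm]
  congr 1
  refine Finset.sum_congr rfl fun v _ => ?_
  rw [← Finset.card_filter]
  congr 1
  ext f
  rw [Finset.mem_filter, hmem, mem_weakMaps_univ]

end Permutohedron

/-- Reciprocity for generalized permutohedra: `p(m)` counts the `f : [n] → [m]` minimizing
uniquely over `Q`, `p*(m)` sums the numbers of minimizing vertices, and
`p(-X) = (-1)ⁿ p*(X)`. -/
theorem stmt11 (n : ℕ) (Q : Set (Fin n → ℝ)) (hQ : IsGenPermutohedron n Q) :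
    ∃ p pstar : Polynomial ℚ,
      (∀ m : ℕ, 1 ≤ m → p.eval (m : ℚ) =
        Nat.card {f : Fin n → ℕ // (∀ i, 1 ≤ f i ∧ f i ≤ m) ∧
          ∃! x : Fin n → ℝ, x ∈ Q ∧ ∀ y ∈ Q,
            ∑ i, (f i : ℝ) * x i ≤ ∑ i, (f i : ℝ) * y i}) ∧
      (∀ m : ℕ, 1 ≤ m → pstar.eval (m : ℚ) =
        ∑ᶠ f ∈ {f : Fin n → ℕ | ∀ i, 1 ≤ f i ∧ f i ≤ m},
          (Nat.card {x : Fin n → ℝ // x ∈ Set.extremePoints ℝ Q ∧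
            ∀ y ∈ Q, ∑ i, (f i : ℝ) * x i ≤ ∑ i, (f i : ℝ) * y i} : ℚ)) ∧
      p.comp (-Polynomial.X) = (-1) ^ n * pstar := by
  choose! q hq using fun v (hv : v ∈ Q.extremePoints ℝ) =>
    exists_orderPolynomial (hQ.exists_exchangeRel_lt hv).choose_spec Finset.univ
  set P := ∑ v ∈ hQ.finite_extremePoints.toFinset, q v with hP
  refine ⟨(-1) ^ n * P.comp (-Polynomial.X), P, fun m _ => ?_, fun m _ => ?_, ?_⟩
  · rw [hQ.card_unique_minimizer, Polynomial.eval_mul, Polynomial.eval_comp, hP,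
      Polynomial.eval_finsetSum, Finset.mul_sum, Nat.cast_sum]
    refine Finset.sum_congr rfl fun v hv => ?_
    rw [Set.Finite.mem_toFinset] at hv
    rw [Polynomial.eval_neg, Polynomial.eval_X, (hq v hv).2 m, Finset.card_univ, Fintype.card_fin]
    rw [← mul_assoc, Polynomial.eval_pow, Polynomial.eval_neg, Polynomial.eval_one, ← mul_pow,
      neg_one_mul, neg_neg, one_pow, one_mul]
  · rw [hQ.finsum_card_minimizing_vertices, hP, Polynomial.eval_finsetSum]
    refine Finset.sum_congr rfl fun v hv => ?_
    rw [Set.Finite.mem_toFinset] at hv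
    exact (hq v hv).1 m
  · simp [Polynomial.mul_comp, Polynomial.comp_assoc]
end

section
/- Let Q ⊆ ℝⁿ be a generalized n-permutohedron, i.e. a polytope (convex hull of a nonempty finite set) each of whose edges is parallel to e_i − e_j for some i ≠ j. Then for every injective function f : {1,…,n} → ℙ, the linear functional x ↦ Σᵢ f(i)xᵢ attains its minimum over Q at exactly one point (necessarily a vertex of Q). (Consequently the coefficients of F(Q,x) in the fundamental quasisymmetric basis sum to n!.) -/
/-- The face of a polytope on which a linear functional attains its minimum is spanned by the
generators on which it attains this minimum. -/
theorem Finset.convexHull_filter_eq_of_forall_le {E : Type*} [AddCommGroup E] [Module ℝ E]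
    (S : Finset E) (k : Module.Dual ℝ E) (m : ℝ) [DecidablePred fun b => k b = m]
    (hm : ∀ b ∈ S, m ≤ k b) :
    convexHull ℝ (S.filter (fun b => k b = m) : Set E) =
      {x ∈ convexHull ℝ (S : Set E) | k x = m} := by
  apply Set.Subset.antisymm
  · refine convexHull_min (fun b hb => ?_) ?_
    · rw [Finset.mem_coe, Finset.mem_filter] at hb
      exact ⟨subset_convexHull ℝ _ hb.1, hb.2⟩
    · exact (convex_convexHull ℝ _).inter (convex_hyperplane k.isLinear m)
  · rintro x ⟨hx, hkx⟩
    obtain ⟨w, hw0, hw1, hwx⟩ := Finset.mem_convexHull'.1 hx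
    have hsum : ∑ b ∈ S, w b * (k b - m) = 0 := by
      have hk : k x = ∑ b ∈ S, w b * k b := by simp [← hwx, map_sum]
      simp only [mul_sub, Finset.sum_sub_distrib, ← Finset.sum_mul, hw1, ← hk, hkx]
      ring
    have hzero : ∀ b ∈ S, k b ≠ m → w b = 0 := by
      intro b hb hbm
      have := (Finset.sum_eq_zero_iff_of_nonneg
        (fun b hb => mul_nonneg (hw0 b hb) (sub_nonneg.2 (hm b hb)))).1 hsum b hb
      exact (mul_eq_zero.1 this).resolve_right (sub_ne_zero.2 hbm)
    refine Finset.mem_convexHull'.2 ⟨w, fun b hb => hw0 b (Finset.mem_filter.1 hb).1, ?_, ?_⟩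
    · rw [← hw1]
      refine Finset.sum_filter_of_ne fun b hb hne => ?_
      by_contra h
      exact hne (hzero b hb h)
    · rw [← hwx]
      refine Finset.sum_filter_of_ne fun b hb hne => ?_
      by_contra h
      exact hne (by rw [hzero b hb h, zero_smul])

/-- The set on which a linear functional attains a lower bound is an extreme subset. -/
theorem isExtreme_setOf_eq_of_forall_le {E : Type*} [AddCommGroup E] [Module ℝ E]
    {A : Set E} (k : Module.Dual ℝ E) {m : ℝ} (hm : ∀ x ∈ A, m ≤ k x) :
    IsExtreme ℝ A {x ∈ A | k x = m} := by
  refine ⟨fun x hx => hx.1, ?_⟩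
  rintro x hx y hy z ⟨-, hz⟩ ⟨a, b, ha, hb, hab, rfl⟩
  refine ⟨hx, le_antisymm ?_ (hm x hx)⟩
  simp only [map_add, map_smul, smul_eq_mul] at hz
  have h1 := mul_le_mul_of_nonneg_left (hm y hy) hb.le
  have h2 : a * k x ≤ a * m := by
    have : m = a * m + b * m := by rw [← add_mul, hab, one_mul]
    linarith
  exact le_of_mul_le_mul_left h2 ha

/-- A lower bound for a linear functional on a set is a lower bound on its convex hull. -/
theorem le_of_mem_convexHull_of_forall_le {E : Type*} [AddCommGroup E] [Module ℝ E]
    {s : Set E} (k : Module.Dual ℝ E) {m : ℝ} (hm : ∀ b ∈ s, m ≤ k b) {x : E}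
    (hx : x ∈ convexHull ℝ s) : m ≤ k x :=
  convexHull_min (t := {x | m ≤ k x}) hm (convex_halfSpace_ge k.isLinear m) hx

/-- Some linear functional is injective on a given finite set. -/
theorem Finset.exists_dual_injOn {E : Type*} [AddCommGroup E] [Module ℝ E] (S : Finset E) :
    ∃ g : Module.Dual ℝ E, Set.InjOn g (S : Set E) := by
  obtain ⟨g, hg⟩ := Module.exists_dual_forall_apply_ne_zero (K := ℝ)
    (fun p : {p : S × S // p.1 ≠ p.2} => (p.1.1 : E) - p.1.2)
    (fun p => sub_ne_zero.2 fun h => p.2 (Subtype.ext h))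
  refine ⟨g, fun x hx y hy hxy => ?_⟩
  by_contra hne
  exact hg ⟨(⟨x, hx⟩, ⟨y, hy⟩), fun h => hne (congrArg Subtype.val h)⟩
    (by rw [map_sub, hxy, sub_self])

/-- A polytope which is not a single point has an edge. -/
theorem Finset.Nontrivial.exists_isExtreme_segment {E : Type*} [AddCommGroup E] [Module ℝ E]
    {S : Finset E} (hS : S.Nontrivial) :
    ∃ u v : E, u ≠ v ∧ IsExtreme ℝ (convexHull ℝ (S : Set E)) (segment ℝ u v) := by
  classical
  obtain ⟨g, hg⟩ := S.exists_dual_injOn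
  obtain ⟨a, ha, hamin⟩ := S.exists_min_image g hS.nonempty
  have hpos : ∀ b ∈ S.erase a, 0 < g (b - a) := by
    intro b hb
    obtain ⟨hba, hbS⟩ := Finset.mem_erase.1 hb
    rw [map_sub, sub_pos]
    exact lt_of_le_of_ne (hamin b hbS) fun h => hba (hg hbS ha h.symm)
  let slope : E → E := fun b => (g (b - a))⁻¹ • (b - a)
  have hslope : ∀ b ∈ S.erase a, b - a = g (b - a) • slope b := fun b hb => by
    rw [smul_inv_smul₀ (hpos b hb).ne']
  have hT : (S.erase a).Nonempty := by
    obtain ⟨b, hb, hba⟩ := hS.exists_ne a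
    exact ⟨b, Finset.mem_erase.2 ⟨hba, hb⟩⟩
  obtain ⟨h, hh⟩ := ((S.erase a).image slope).exists_dual_injOn
  obtain ⟨b₀, hb₀, hb₀min⟩ := (S.erase a).exists_min_image (fun b => h (slope b)) hT
  let k : Module.Dual ℝ E := h - h (slope b₀) • g
  have hk : ∀ b ∈ S.erase a, k b - k a = g (b - a) * (h (slope b) - h (slope b₀)) := by
    intro b hb
    have h1 : h (b - a) = g (b - a) * h (slope b) := by
      conv_lhs => rw [hslope b hb]
      simp
    rw [← map_sub]
    simp only [k, LinearMap.sub_apply, LinearMap.smul_apply, smul_eq_mul, h1]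
    ring
  have hkmin : ∀ b ∈ S, k a ≤ k b := by
    intro b hb
    by_cases hba : b = a
    · rw [hba]
    · have hb' := Finset.mem_erase.2 ⟨hba, hb⟩
      rw [← sub_nonneg, hk b hb']
      exact mul_nonneg (hpos b hb').le (sub_nonneg.2 (hb₀min b hb'))
  have hkeq : ∀ b ∈ S, k b = k a → b - a = g (b - a) • slope b₀ := by
    intro b hb hbk
    by_cases hba : b = a
    · simp [hba]
    · have hb' := Finset.mem_erase.2 ⟨hba, hb⟩
      have h0 := hk b hb'
      rw [hbk, sub_self, eq_comm, mul_eq_zero, sub_eq_zero] at h0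
      rw [← hh (Finset.mem_image_of_mem _ hb') (Finset.mem_image_of_mem _ hb₀)
        (h0.resolve_left (hpos b hb').ne')]
      exact hslope b hb'
  have hb₀F : b₀ ∈ S.filter (fun b => k b = k a) := by
    refine Finset.mem_filter.2 ⟨Finset.mem_of_mem_erase hb₀, sub_eq_zero.1 ?_⟩
    rw [hk b₀ hb₀, sub_self, mul_zero]
  obtain ⟨c, hc, hcmax⟩ := (S.filter (fun b => k b = k a)).exists_max_image g ⟨b₀, hb₀F⟩
  have hcS := (Finset.mem_filter.1 hc).1
  have hgc : 0 < g (c - a) := by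
    have h1 := hpos b₀ hb₀
    have h2 := hcmax b₀ hb₀F
    rw [map_sub] at h1 ⊢
    linarith
  have hface : segment ℝ a c = {x ∈ convexHull ℝ (S : Set E) | k x = k a} := by
    rw [← S.convexHull_filter_eq_of_forall_le k (k a) hkmin]
    apply Set.Subset.antisymm
    · exact segment_subset_convexHull (by simpa using ha) hc
    · refine convexHull_min (fun b hb => ?_) (convex_segment a c)
      obtain ⟨hbS, hbk⟩ := Finset.mem_filter.1 hb
      have hgb : 0 ≤ g (b - a) := by
        rw [map_sub]
        exact sub_nonneg.2 (hamin b hbS)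
      rw [segment_eq_image']
      refine ⟨g (b - a) / g (c - a), ⟨by positivity, ?_⟩, ?_⟩
      · rw [div_le_one hgc, map_sub, map_sub]
        linarith [hcmax b hb]
      · change a + (g (b - a) / g (c - a)) • (c - a) = b
        have hca := hkeq c hcS (Finset.mem_filter.1 hc).2
        have hba : (g (b - a) / g (c - a)) • (c - a) = b - a := by
          nth_rewrite 2 [hca]
          rw [smul_smul, div_mul_cancel₀ _ hgc.ne', ← hkeq b hbS hbk]
        rw [hba, add_sub_cancel]
  refine ⟨a, c, fun hac => ?_, ?_⟩
  · simp [hac] at hgc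
  · rw [hface]
    exact isExtreme_setOf_eq_of_forall_le k
      fun x hx => le_of_mem_convexHull_of_forall_le k hkmin hx

/-- For a generalized permutohedron, any injective positive weight vector minimizes at a
unique point. -/
theorem stmt12 (n : ℕ) (Q : Set (Fin n → ℝ)) (hQ : IsGenPermutohedron n Q)
    (f : Fin n → ℕ) (hf : ∀ i, 1 ≤ f i) (hinj : Function.Injective f) :
    ∃! x : Fin n → ℝ, x ∈ Q ∧ ∀ y ∈ Q,
      ∑ i, (f i : ℝ) * x i ≤ ∑ i, (f i : ℝ) * y i := by
  classical
  obtain ⟨⟨V, hV, rfl⟩, hedge⟩ := hQ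
  let k : Module.Dual ℝ (Fin n → ℝ) := ∑ i, (f i : ℝ) • LinearMap.proj i
  have hk : ∀ x : Fin n → ℝ, ∑ i, (f i : ℝ) * x i = k x := fun x => by simp [k]
  simp only [hk]
  obtain ⟨a, ha, hamin⟩ := V.exists_min_image k hV
  have hmin : ∀ x ∈ convexHull ℝ (V : Set (Fin n → ℝ)), k a ≤ k x :=
    fun x hx => le_of_mem_convexHull_of_forall_le k hamin hx
  have haV : a ∈ convexHull ℝ (V : Set (Fin n → ℝ)) := subset_convexHull ℝ _ ha
  refine ⟨a, ⟨haV, hmin⟩, ?_⟩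
  rintro y ⟨hy, hymin⟩
  have hface := V.convexHull_filter_eq_of_forall_le k (k a) hamin
  have hext := isExtreme_setOf_eq_of_forall_le k hmin
  have hyF : y ∈ convexHull ℝ (V.filter (fun b => k b = k a) : Set (Fin n → ℝ)) := by
    rw [hface]
    exact ⟨hy, le_antisymm (hymin a haV) (hmin y hy)⟩
  by_contra hya
  have hnt : (V.filter (fun b => k b = k a)).Nontrivial := by
    by_contra hnt
    have hsub : V.filter (fun b => k b = k a) ⊆ {a} := fun b hb => by
      by_contra hba
      exact hnt ⟨b, hb, a, by simpa using ha, by simpa using hba⟩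
    have := convexHull_mono (𝕜 := ℝ) (Finset.coe_subset.2 hsub) hyF
    rw [Finset.coe_singleton, convexHull_singleton] at this
    exact hya this
  obtain ⟨u, v, huv, hseg⟩ := hnt.exists_isExtreme_segment
  rw [hface] at hseg
  obtain ⟨i, j, hij, c, hc, hcuv⟩ := hedge u v huv (hext.trans hseg)
  have hu := (hseg.subset (left_mem_segment ℝ u v)).2
  have hv := (hseg.subset (right_mem_segment ℝ u v)).2
  have hzero : c * ((f i : ℝ) - f j) = 0 := by
    have hkuv : k (v - u) = 0 := by rw [map_sub, hu, hv, sub_self]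
    rw [hcuv, map_smul, map_sub, ← hk, ← hk] at hkuv
    simpa [Pi.single_apply] using hkuv
  have hfij := sub_eq_zero.1 ((mul_eq_zero.1 hzero).resolve_left hc)
  exact hij (hinj (by exact_mod_cast hfij))
end
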